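/- arXiv:2203.12763 — 7 statements merged into one kernel-verified Lean document; each statement's English description precedes it below -/
import Mathlib

section
/- Fix x₀ ∈ ℝ. Let ω be an N×N complex matrix-valued kernel satisfying the J-symmetry ω(y,z) = J·ω(z,y)†·J for all y, z < x₀. Let r be a kernel on (-∞,x₀)×(-∞,x₀) satisfying both resolvent equations r(z,y) + ω(z,y) + ∫_{-∞}^{x₀} r(z,s)·ω(s,y) ds = 0 and r(z,y) + ω(z,y) + ∫_{-∞}^{x₀} ω(z,s)·r(s,y) ds = 0 for all z, y < x₀. Assume uniqueness in the form: every measurable kernel h on (-∞,x₀)×(-∞,x₀) (with absolutely convergent integrals) satisfying h(z,y) + ∫_{-∞}^{x₀} h(z,s)·ω(s,y) ds = 0 for all z, y < x₀ vanishes identically. Then r satisfies the J-symmetry r(z,y) = J·r(y,z)†·J for all z, y < x₀. -/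
open MeasureTheory Set Matrix

/-- Entrywise integral of a matrix-valued function over a set of reals. -/
noncomputable def mInt {N : ℕ} (s : Set ℝ) (F : ℝ → Matrix (Fin N) (Fin N) ℂ) :
    Matrix (Fin N) (Fin N) ℂ :=
  Matrix.of fun i j => ∫ t in s, F t i j

theorem aux_entry {N : ℕ} (J F : Matrix (Fin N) (Fin N) ℂ) (i j : Fin N) :
    (J * Fᴴ * J) i j = ∑ k, ∑ l, J i l * star (F k l) * J k j := by
  simp [Matrix.mul_apply, Finset.sum_mul]

theorem aux_int {N : ℕ} (S : Set ℝ) (J : Matrix (Fin N) (Fin N) ℂ)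
    (F : ℝ → Matrix (Fin N) (Fin N) ℂ)
    (hF : ∀ i j, IntegrableOn (fun s => F s i j) S) (i j : Fin N) :
    IntegrableOn (fun s => (J * (F s)ᴴ * J) i j) S := by
  simp only [aux_entry]
  refine integrable_finsetSum _ fun k _ => integrable_finsetSum _ fun l _ => ?_
  refine Integrable.mul_const (Integrable.const_mul ?_ _) _
  exact (Complex.conjCLE.toContinuousLinearMap.integrable_comp (hF k l) :)

theorem aux_mInt {N : ℕ} (S : Set ℝ) (J : Matrix (Fin N) (Fin N) ℂ)
    (F : ℝ → Matrix (Fin N) (Fin N) ℂ)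
    (hF : ∀ i j, IntegrableOn (fun s => F s i j) S) :
    mInt S (fun s => J * (F s)ᴴ * J) = J * (mInt S F)ᴴ * J := by
  have hc : ∀ k l, IntegrableOn (fun s => star (F s k l)) S := fun k l =>
    (Complex.conjCLE.toContinuousLinearMap.integrable_comp (hF k l) :)
  ext i j
  rw [aux_entry]
  simp only [mInt, Matrix.of_apply, aux_entry]
  rw [integral_finsetSum _ fun k _ => integrable_finsetSum _ fun l _ =>
    Integrable.mul_const (Integrable.const_mul (hc k l) _) _]
  refine Finset.sum_congr rfl fun k _ => ?_
  rw [integral_finsetSum _ fun l _ =>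
    Integrable.mul_const (Integrable.const_mul (hc k l) _) _]
  refine Finset.sum_congr rfl fun l _ => ?_
  rw [integral_mul_const, integral_const_mul]
  congr 2
  exact integral_conj

/-- if `ω` is J-symmetric and the resolvent kernel `r` on `(-∞,x₀)` satisfies
both resolvent equations, then under the stated uniqueness assumption `r` is J-symmetric. -/
theorem resolvent_Jsymmetry_on_Iio
    (N : ℕ) (hN : 0 < N) (J : Matrix (Fin N) (Fin N) ℂ)
    (hJsa : Jᴴ = J) (hJinv : J * J = 1)
    (x₀ : ℝ) (ω r : ℝ → ℝ → Matrix (Fin N) (Fin N) ℂ)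
    -- measurability of the kernels
    (hωmeas : ∀ i j, Measurable fun p : ℝ × ℝ => ω p.1 p.2 i j)
    (hrmeas : ∀ i j, Measurable fun p : ℝ × ℝ => r p.1 p.2 i j)
    -- J-symmetry of ω
    (hωsym : ∀ y z, y < x₀ → z < x₀ → ω y z = J * (ω z y)ᴴ * J)
    -- absolute convergence of the integrals in the two resolvent equations
    (hint1 : ∀ z y, z < x₀ → y < x₀ → ∀ i j,
      IntegrableOn (fun s => (r z s * ω s y) i j) (Iio x₀))
    (hint2 : ∀ z y, z < x₀ → y < x₀ → ∀ i j,
      IntegrableOn (fun s => (ω z s * r s y) i j) (Iio x₀))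
    -- the two resolvent equations
    (hres1 : ∀ z y, z < x₀ → y < x₀ →
      r z y + ω z y + mInt (Iio x₀) (fun s => r z s * ω s y) = 0)
    (hres2 : ∀ z y, z < x₀ → y < x₀ →
      r z y + ω z y + mInt (Iio x₀) (fun s => ω z s * r s y) = 0)
    -- uniqueness: any measurable kernel solving the homogeneous equation vanishes
    (huniq : ∀ h : ℝ → ℝ → Matrix (Fin N) (Fin N) ℂ,
      (∀ i j, Measurable fun p : ℝ × ℝ => h p.1 p.2 i j) →
      (∀ z y, z < x₀ → y < x₀ → ∀ i j,
        IntegrableOn (fun s => (h z s * ω s y) i j) (Iio x₀)) →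
      (∀ z y, z < x₀ → y < x₀ →
        h z y + mInt (Iio x₀) (fun s => h z s * ω s y) = 0) →
      ∀ z y, z < x₀ → y < x₀ → h z y = 0) :
    -- conclusion: J-symmetry of the resolvent kernel
    ∀ z y, z < x₀ → y < x₀ → r z y = J * (r y z)ᴴ * J := by
  have key : ∀ z y, y < x₀ → ∀ s, s < x₀ →
      (J * (r s z)ᴴ * J) * ω s y = J * (ω y s * r s z)ᴴ * J := by
    intro z y hy s hs
    rw [hωsym s y hs hy, Matrix.conjTranspose_mul]
    simp only [Matrix.mul_assoc]
    rw [← Matrix.mul_assoc J J, hJinv, Matrix.one_mul]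
  have hI : ∀ z y, z < x₀ → y < x₀ → ∀ i j,
      IntegrableOn (fun s => ((J * (r s z)ᴴ * J) * ω s y) i j) (Iio x₀) := by
    intro z y hz hy i j
    refine (aux_int (Iio x₀) J (fun s => ω y s * r s z) (hint2 y z hy hz) i j).congr_fun
      (fun s hs => ?_) measurableSet_Iio
    simp only [key z y hy s hs]
  have hM : ∀ z y, z < x₀ → y < x₀ →
      mInt (Iio x₀) (fun s => (J * (r s z)ᴴ * J) * ω s y)
        = J * (mInt (Iio x₀) (fun s => ω y s * r s z))ᴴ * J := by
    intro z y hz hy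
    rw [← aux_mInt _ _ _ (hint2 y z hy hz)]
    ext i j
    simp only [mInt, Matrix.of_apply]
    refine setIntegral_congr_fun measurableSet_Iio fun s hs => ?_
    simp only [key z y hy s hs]
  intro z y hz hy
  refine sub_eq_zero.1 (huniq (fun z y => r z y - J * (r y z)ᴴ * J) ?_ ?_ ?_ z y hz hy)
  · intro i j
    simp only [Matrix.sub_apply, aux_entry]
    refine (hrmeas i j).sub (Finset.measurable_sum _ fun k _ => Finset.measurable_sum _ fun l _ => ?_)
    refine (Measurable.const_mul ?_ _).mul_const _
    exact Complex.continuous_conj.measurable.comp ((hrmeas k l).comp measurable_swap)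
  · intro z y hz hy i j
    simp only [Matrix.sub_mul, Matrix.sub_apply]
    exact (hint1 z y hz hy i j).sub (hI z y hz hy i j)
  · intro z y hz hy
    have e : mInt (Iio x₀) (fun s => (r z s - J * (r s z)ᴴ * J) * ω s y)
        = mInt (Iio x₀) (fun s => r z s * ω s y)
          - mInt (Iio x₀) (fun s => (J * (r s z)ᴴ * J) * ω s y) := by
      ext i j
      simp only [mInt, Matrix.of_apply, Matrix.sub_mul, Matrix.sub_apply]
      exact integral_sub (hint1 z y hz hy i j) (hI z y hz hy i j)
    have h2 : J * (r y z)ᴴ * J + ω z y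
        + J * (mInt (Iio x₀) (fun s => ω y s * r s z))ᴴ * J = 0 := by
      have := congrArg (fun A => J * Aᴴ * J) (hres2 y z hy hz)
      simp only [Matrix.conjTranspose_add, Matrix.mul_add, Matrix.add_mul,
        Matrix.conjTranspose_zero, Matrix.mul_zero, Matrix.zero_mul] at this
      rwa [← hωsym z y hz hy] at this
    have h1 := hres1 z y hz hy
    rw [e, hM z y hz hy]
    have h3 := congrArg₂ (fun A B => A - B) h1 h2
    simp only [sub_zero] at h3
    rw [← h3]
    abel
end

section
/- Fix x₀ ∈ ℝ. Let ω and α be N×N complex matrix-valued kernels such that α satisfies the fundamental integral equation α(x₀,y) + ω(x₀,y) + ∫_{-∞}^{x₀} α(x₀,z)·ω(z,y) dz = 0 for all y < x₀. Let r be a kernel on (-∞,x₀)×(-∞,x₀) satisfying the resolvent equation r(z,y) + ω(z,y) + ∫_{-∞}^{x₀} r(z,s)·ω(s,y) ds = 0 for all z, y < x₀. Let f and g be N×N complex matrix-valued functions on (-∞,x₀], and set the perturbed kernel ω̃(z,y) := ω(z,y) + f(z)·g(y). Define g̃(y) := g(y) + ∫_{-∞}^{x₀} g(z)·r(z,y)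 dz, n := f(x₀) + ∫_{-∞}^{x₀} α(x₀,z)·f(z) dz, and Γ := I + ∫_{-∞}^{x₀} g̃(z)·f(z) dz, and assume the matrix Γ is invertible. Then the kernel α̃(y) := α(x₀,y) − n·Γ⁻¹·g̃(y) satisfies the perturbed fundamental integral equation α̃(y) + ω̃(x₀,y) + ∫_{-∞}^{x₀} α̃(z)·ω̃(z,y) dz = 0 for all y < x₀. -/
open MeasureTheory Set Matrix

lemma mInt_add' {N : ℕ} {s : Set ℝ} {F G : ℝ → Matrix (Fin N) (Fin N) ℂ}
    (hF : ∀ i j, IntegrableOn (fun z => F z i j) s)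
    (hG : ∀ i j, IntegrableOn (fun z => G z i j) s) :
    mInt s (fun z => F z + G z) = mInt s F + mInt s G := by
  ext i j
  simp only [mInt, Matrix.of_apply, Matrix.add_apply]
  exact integral_add (hF i j) (hG i j)

lemma mInt_intg_mul_left {N : ℕ} {s : Set ℝ} {F : ℝ → Matrix (Fin N) (Fin N) ℂ}
    (A : Matrix (Fin N) (Fin N) ℂ)
    (hF : ∀ i j, IntegrableOn (fun z => F z i j) s) :
    ∀ i j, IntegrableOn (fun z => (A * F z) i j) s := by
  intro i j
  simp only [Matrix.mul_apply]
  exact integrable_finsetSum _ (fun k _ => (hF k j).const_mul _)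

lemma mInt_intg_mul_right {N : ℕ} {s : Set ℝ} {F : ℝ → Matrix (Fin N) (Fin N) ℂ}
    (A : Matrix (Fin N) (Fin N) ℂ)
    (hF : ∀ i j, IntegrableOn (fun z => F z i j) s) :
    ∀ i j, IntegrableOn (fun z => (F z * A) i j) s := by
  intro i j
  simp only [Matrix.mul_apply]
  exact integrable_finsetSum _ (fun k _ => (hF i k).mul_const _)

lemma mInt_mul_left {N : ℕ} {s : Set ℝ} {F : ℝ → Matrix (Fin N) (Fin N) ℂ}
    (A : Matrix (Fin N) (Fin N) ℂ)
    (hF : ∀ i j, IntegrableOn (fun z => F z i j) s) :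
    mInt s (fun z => A * F z) = A * mInt s F := by
  ext i j
  simp only [mInt, Matrix.of_apply, Matrix.mul_apply]
  rw [integral_finsetSum _ (fun k _ => (hF k j).const_mul _)]
  simp only [integral_const_mul]

lemma mInt_mul_right {N : ℕ} {s : Set ℝ} {F : ℝ → Matrix (Fin N) (Fin N) ℂ}
    (A : Matrix (Fin N) (Fin N) ℂ)
    (hF : ∀ i j, IntegrableOn (fun z => F z i j) s) :
    mInt s (fun z => F z * A) = mInt s F * A := by
  ext i j
  simp only [mInt, Matrix.of_apply, Matrix.mul_apply]
  rw [integral_finsetSum _ (fun k _ => (hF i k).mul_const _)]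
  simp only [integral_mul_const]

lemma mInt_congr' {N : ℕ} {s : Set ℝ} (hs : MeasurableSet s)
    {F G : ℝ → Matrix (Fin N) (Fin N) ℂ} (h : ∀ z ∈ s, F z = G z) :
    mInt s F = mInt s G := by
  ext i j
  simp only [mInt, Matrix.of_apply]
  exact setIntegral_congr_fun hs (fun z hz => by simp only [h z hz])

lemma mInt_intg_congr {N : ℕ} {s : Set ℝ} (hs : MeasurableSet s)
    {F G : ℝ → Matrix (Fin N) (Fin N) ℂ} (h : ∀ z ∈ s, F z = G z)
    (hF : ∀ i j, IntegrableOn (fun z => F z i j) s) :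
    ∀ i j, IntegrableOn (fun z => G z i j) s := fun i j =>
  (hF i j).congr_fun (fun z hz => by simp only [h z hz]) hs

lemma mInt_swap {N : ℕ} {s : Set ℝ} {K : ℝ → ℝ → Matrix (Fin N) (Fin N) ℂ}
    (hK : ∀ i j, IntegrableOn (fun p : ℝ × ℝ => K p.1 p.2 i j) (s ×ˢ s)) :
    mInt s (fun z => mInt s (fun t => K t z)) = mInt s (fun t => mInt s (fun z => K t z)) := by
  ext i j
  simp only [mInt, Matrix.of_apply]
  have h := hK i j
  rw [IntegrableOn, Measure.volume_eq_prod, ← Measure.prod_restrict] at h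
  exact (integral_integral_swap (f := fun t z => K t z i j) h).symm

lemma mInt_intg_swap {N : ℕ} {s : Set ℝ} {K : ℝ → ℝ → Matrix (Fin N) (Fin N) ℂ}
    (hK : ∀ i j, IntegrableOn (fun p : ℝ × ℝ => K p.1 p.2 i j) (s ×ˢ s)) :
    ∀ i j, IntegrableOn (fun z => mInt s (fun t => K t z) i j) s := by
  intro i j
  simp only [mInt, Matrix.of_apply]
  have h := hK i j
  rw [IntegrableOn, Measure.volume_eq_prod, ← Measure.prod_restrict] at h
  exact h.integral_prod_right

/-- on `(-∞,x₀)`, the kernel `α̃ = α(x₀,·) − n Γ⁻¹ g̃` solves the perturbed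
fundamental integral equation with the rank-one perturbed kernel `ω̃ = ω + f·g`. -/
theorem perturbed_fundamental_equation_on_Iio
    (N : ℕ) (hN : 0 < N) (x₀ : ℝ)
    (ω α r : ℝ → ℝ → Matrix (Fin N) (Fin N) ℂ)
    (f g : ℝ → Matrix (Fin N) (Fin N) ℂ)
    (gt : ℝ → Matrix (Fin N) (Fin N) ℂ) (n Γ : Matrix (Fin N) (Fin N) ℂ)
    -- absolute convergence of the integral in the fundamental equation
    (hfund_int : ∀ y, y < x₀ → ∀ i j,
      IntegrableOn (fun z => (α x₀ z * ω z y) i j) (Iio x₀))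
    -- the fundamental integral equation at x₀
    (hfund : ∀ y, y < x₀ →
      α x₀ y + ω x₀ y + mInt (Iio x₀) (fun z => α x₀ z * ω z y) = 0)
    -- absolute convergence of the integral in the resolvent equation
    (hres_int : ∀ z y, z < x₀ → y < x₀ → ∀ i j,
      IntegrableOn (fun s => (r z s * ω s y) i j) (Iio x₀))
    -- the resolvent equation
    (hres : ∀ z y, z < x₀ → y < x₀ →
      r z y + ω z y + mInt (Iio x₀) (fun s => r z s * ω s y) = 0)
    -- definition of g̃
    (hgt_int : ∀ y, y < x₀ → ∀ i j,
      IntegrableOn (fun z => (g z * r z y) i j) (Iio x₀))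
    (hgt : ∀ y, y < x₀ → gt y = g y + mInt (Iio x₀) (fun z => g z * r z y))
    -- definition of n
    (hn_int : ∀ i j, IntegrableOn (fun z => (α x₀ z * f z) i j) (Iio x₀))
    (hn : n = f x₀ + mInt (Iio x₀) (fun z => α x₀ z * f z))
    -- definition of Γ, assumed invertible
    (hΓ_int : ∀ i j, IntegrableOn (fun z => (gt z * f z) i j) (Iio x₀))
    (hΓ : Γ = 1 + mInt (Iio x₀) (fun z => gt z * f z))
    (hΓinv : IsUnit Γ)
    -- absolute convergence of the remaining integrals appearing
    (hgω_int : ∀ y, y < x₀ → ∀ i j,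
      IntegrableOn (fun z => (g z * ω z y) i j) (Iio x₀))
    (hconc_int : ∀ y, y < x₀ → ∀ i j,
      IntegrableOn (fun z =>
        ((α x₀ z - n * Γ⁻¹ * gt z) * (ω z y + f z * g y)) i j) (Iio x₀))
    -- absolute convergence of the iterated integrals (so orders may be interchanged)
    (hFub : ∀ y, y < x₀ → ∀ i j,
      IntegrableOn (fun p : ℝ × ℝ => (g p.1 * r p.1 p.2 * ω p.2 y) i j)
        ((Iio x₀) ×ˢ (Iio x₀))) :
    -- conclusion: the perturbed fundamental integral equation
    ∀ y, y < x₀ →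
      (α x₀ y - n * Γ⁻¹ * gt y) + (ω x₀ y + f x₀ * g y)
        + mInt (Iio x₀) (fun z => (α x₀ z - n * Γ⁻¹ * gt z) * (ω z y + f z * g y)) = 0 := by
  intro y hy
  have hs : MeasurableSet (Iio x₀) := measurableSet_Iio
  have hK := hFub y hy
  have e1 : ∀ z ∈ Iio x₀, mInt (Iio x₀) (fun t => g t * r t z * ω z y)
      = mInt (Iio x₀) (fun t => g t * r t z) * ω z y := fun z hz =>
    mInt_mul_right (ω z y) (hgt_int z hz)
  have e2 : ∀ z ∈ Iio x₀, mInt (Iio x₀) (fun t => g z * r z t * ω t y)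
      = g z * mInt (Iio x₀) (fun t => r z t * ω t y) := fun z hz => by
    rw [← mInt_mul_left (g z) (hres_int z y hz hy)]
    simp only [Matrix.mul_assoc]
  have hI1 := mInt_intg_congr hs e1
    (mInt_intg_swap (K := fun t z => g t * r t z * ω z y) hK)
  have e3 : ∀ z ∈ Iio x₀, g z * ω z y + mInt (Iio x₀) (fun t => g t * r t z) * ω z y
      = gt z * ω z y := fun z hz => by rw [hgt z hz, Matrix.add_mul]
  have hI2 : ∀ i j, IntegrableOn (fun z => (gt z * ω z y) i j) (Iio x₀) :=
    mInt_intg_congr hs e3 (fun i j => (hgω_int y hy i j).add (hI1 i j))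
  have e4 : ∀ z ∈ Iio x₀, g z * mInt (Iio x₀) (fun t => r z t * ω t y)
      = (-1 : Matrix (Fin N) (Fin N) ℂ) * (g z * r z y)
        + (-1 : Matrix (Fin N) (Fin N) ℂ) * (g z * ω z y) := fun z hz => by
    have h := hres z y hz hy
    rw [eq_neg_of_add_eq_zero_right h]
    noncomm_ring
  have key : mInt (Iio x₀) (fun z => gt z * ω z y) = g y - gt y := by
    rw [← mInt_congr' hs e3, mInt_add' (hgω_int y hy) hI1, ← mInt_congr' hs e1,
      mInt_swap (K := fun t z => g t * r t z * ω z y) hK, mInt_congr' hs e2,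
      mInt_congr' hs e4,
      mInt_add' (mInt_intg_mul_left _ (hgt_int y hy)) (mInt_intg_mul_left _ (hgω_int y hy)),
      mInt_mul_left _ (hgt_int y hy), mInt_mul_left _ (hgω_int y hy), hgt y hy]
    noncomm_ring
  have hA : mInt (Iio x₀) (fun z => α x₀ z * f z) = n - f x₀ := by rw [hn]; abel
  have hG : mInt (Iio x₀) (fun z => gt z * f z) = Γ - 1 := by rw [hΓ]; abel
  have hF := hfund y hy
  have e5 : ∀ z ∈ Iio x₀, (α x₀ z - n * Γ⁻¹ * gt z) * (ω z y + f z * g y)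
      = (α x₀ z * ω z y + α x₀ z * f z * g y)
        + (-(n * Γ⁻¹)) * (gt z * ω z y + gt z * f z * g y) := fun z _ => by
    noncomm_ring
  have i1 := mInt_intg_mul_right (g y) hn_int
  have i2 := mInt_intg_mul_right (g y) hΓ_int
  have i3 : ∀ i j, IntegrableOn (fun z => (gt z * ω z y + gt z * f z * g y) i j) (Iio x₀) :=
    fun i j => (hI2 i j).add (i2 i j)
  have i4 : ∀ i j, IntegrableOn (fun z => (α x₀ z * ω z y + α x₀ z * f z * g y) i j) (Iio x₀) :=
    fun i j => (hfund_int y hy i j).add (i1 i j)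
  rw [mInt_congr' hs e5, mInt_add' i4
      (mInt_intg_mul_left _ i3), mInt_add' (hfund_int y hy) i1, mInt_mul_left _ i3,
      mInt_add' hI2 i2, mInt_mul_right _ hn_int, mInt_mul_right _ hΓ_int, key, hA, hG,
      eq_neg_of_add_eq_zero_right hF]
  have hc : n * Γ⁻¹ * (Γ * g y) = n * g y := by
    rw [Matrix.mul_assoc, ← Matrix.mul_assoc Γ⁻¹,
      Matrix.nonsing_inv_mul _ ((Matrix.isUnit_iff_isUnit_det _).1 hΓinv), Matrix.one_mul]
  have e6 : g y - gt y + (Γ - 1) * g y = Γ * g y - gt y := by noncomm_ring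
  rw [e6, Matrix.neg_mul, Matrix.mul_sub, hc, Matrix.sub_mul]
  abel
end

section
/- Let u: ℝ → ℝ be continuous, let κ > 0 and c > 0 be real, and let k ∈ ℂ. Let h: ℝ → ℝ be twice continuously differentiable with −h'' + u·h = −κ²·h on ℝ, and let f: ℝ → ℂ be twice continuously differentiable with −f'' + u·f = k²·f on ℝ. Assume: h² is integrable on (a,∞) for every a ∈ ℝ; f·h is integrable on (a,∞) for every a ∈ ℝ; f'(y)h(y) − f(y)h'(y) → 0 as y → +∞. Define Γ(x) := 1 + c²·∫_x^∞ h(z)² dz (so Γ(x) > 0), the perturbed potential ũ(x) := u(x) − 2·(d²/dx²) log Γ(x), and the perturbed wavefunction f̃(x) := f(x) − c²·h(x)·(∫_x^∞ f(y)h(y) dy) / Γ(x). Then f̃ is twice differentiable and −f̃''(x) + ũ(x)·f̃(x) = k²·f̃(x) for all x ∈ ℝ. -/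
open MeasureTheory Set Filter

lemma aux_eq {E : Type*} [NormedAddCommGroup E] [NormedSpace ℝ E] [CompleteSpace E]
    (g : ℝ → E) (hi : ∀ a : ℝ, IntegrableOn g (Ioi a)) (x : ℝ) :
    ∫ y in Ioi x, g y = (∫ y in Ioi (0:ℝ), g y) - ∫ y in (0:ℝ)..x, g y := by
  have := intervalIntegral.integral_Ioi_sub_Ioi' (hi 0) (hi x)
  rw [← this]; abel

lemma aux_deriv {E : Type*} [NormedAddCommGroup E] [NormedSpace ℝ E] [CompleteSpace E]
    (g : ℝ → E) (hg : Continuous g) (hi : ∀ a : ℝ, IntegrableOn g (Ioi a)) (x : ℝ) :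
    HasDerivAt (fun x => ∫ y in Ioi x, g y) (-(g x)) x := by
  have h1 : HasDerivAt (fun x => ∫ y in (0:ℝ)..x, g y) (g x) x :=
    intervalIntegral.integral_hasDerivAt_right (hg.intervalIntegrable _ _)
      hg.stronglyMeasurable.stronglyMeasurableAtFilter hg.continuousAt
  rw [funext (aux_eq g hi)]
  exact h1.const_sub _

lemma aux_lim {E : Type*} [NormedAddCommGroup E] [NormedSpace ℝ E] [CompleteSpace E]
    (g : ℝ → E) (hi : ∀ a : ℝ, IntegrableOn g (Ioi a)) :
    Tendsto (fun x => ∫ y in Ioi x, g y) atTop (nhds 0) := by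
  rw [funext (aux_eq g hi)]
  have := (intervalIntegral_tendsto_integral_Ioi 0 (hi 0) tendsto_id).const_sub
    (∫ y in Ioi (0:ℝ), g y)
  simpa using this

/-- the Darboux transformation on the full line, expressed through the
Marchenko equation on `(x,+∞)`: the transformed wavefunction `f̃` solves the Schrödinger
equation with the transformed potential `ũ` at energy `k²`. -/
theorem darboux_transformation_Ioi
    (u : ℝ → ℝ) (hu : Continuous u) (κ c : ℝ) (hκ : 0 < κ) (hc : 0 < c) (k : ℂ)
    (h : ℝ → ℝ) (hh : ContDiff ℝ 2 h)
    (hheq : ∀ x, -(deriv (deriv h) x) + u x * h x = -κ ^ 2 * h x)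
    (f : ℝ → ℂ) (hf : ContDiff ℝ 2 f)
    (hfeq : ∀ x, -(deriv (deriv f) x) + (u x : ℂ) * f x = k ^ 2 * f x)
    (hh2int : ∀ a : ℝ, IntegrableOn (fun z => h z ^ 2) (Ioi a))
    (hfhint : ∀ a : ℝ, IntegrableOn (fun y => f y * (h y : ℂ)) (Ioi a))
    (hlim : Tendsto (fun y => deriv f y * (h y : ℂ) - f y * ((deriv h y : ℝ) : ℂ))
      atTop (nhds 0))
    -- Γ(x) = 1 + c² ∫_x^∞ h(z)² dz
    (Γ : ℝ → ℝ) (hΓ : ∀ x, Γ x = 1 + c ^ 2 * ∫ z in Ioi x, h z ^ 2)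
    -- the perturbed potential ũ(x) = u(x) − 2 (log Γ(x))''
    (ut : ℝ → ℝ)
    (hut : ∀ x, ut x = u x - 2 * deriv (deriv fun t => Real.log (Γ t)) x)
    -- the perturbed wavefunction f̃(x) = f(x) − c² h(x) (∫_x^∞ f h) / Γ(x)
    (ft : ℝ → ℂ)
    (hft : ∀ x, ft x = f x
      - (c : ℂ) ^ 2 * (h x : ℂ) * (∫ y in Ioi x, f y * (h y : ℂ)) / (Γ x : ℂ)) :
    (∀ x, 0 < Γ x) ∧ (Differentiable ℝ ft ∧ Differentiable ℝ (deriv ft)) ∧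
      ∀ x, -(deriv (deriv ft) x) + (ut x : ℂ) * ft x = k ^ 2 * ft x := by
  have dh : ∀ x, HasDerivAt h (deriv h x) x := fun x =>
    (hh.differentiable (by norm_num)).differentiableAt.hasDerivAt
  have df : ∀ x, HasDerivAt f (deriv f x) x := fun x =>
    (hf.differentiable (by norm_num)).differentiableAt.hasDerivAt
  have hh' : ContDiff ℝ 1 (deriv h) := hh.deriv'
  have hf' : ContDiff ℝ 1 (deriv f) := hf.deriv'
  have ddh : ∀ x, HasDerivAt (deriv h) ((u x + κ ^ 2) * h x) x := fun x => by
    have := (hh'.differentiable (by norm_num)).differentiableAt.hasDerivAt (x := x)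
    refine HasDerivAt.congr_deriv this ?_
    linear_combination -(hheq x)
  have ddf : ∀ x, HasDerivAt (deriv f) (((u x : ℂ) - k ^ 2) * f x) x := fun x => by
    have := (hf'.differentiable (by norm_num)).differentiableAt.hasDerivAt (x := x)
    refine HasDerivAt.congr_deriv this ?_
    linear_combination -(hfeq x)
  have hΓpos : ∀ x, 0 < Γ x := fun x => by
    rw [hΓ]
    have : 0 ≤ ∫ z in Ioi x, h z ^ 2 := integral_nonneg fun z => sq_nonneg _
    positivity
  set g : ℝ → ℂ := fun y => f y * (h y : ℂ) with hg
  have hgc : Continuous g := hf.continuous.mul (Complex.continuous_ofReal.comp hh.continuous)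
  obtain ⟨I, hI⟩ : ∃ I : ℝ → ℂ, I = fun x => ∫ y in Ioi x, g y := ⟨_, rfl⟩
  have dI : ∀ x, HasDerivAt I (-(f x * (h x : ℂ))) x := fun x => by
    rw [hI]; exact aux_deriv g hgc hfhint x
  have dΓ : ∀ x, HasDerivAt Γ (-c ^ 2 * h x ^ 2) x := fun x => by
    rw [funext hΓ]
    have := ((aux_deriv _ (hh.continuous.pow 2) hh2int x).const_mul (c ^ 2)).const_add 1
    refine HasDerivAt.congr_deriv this ?_
    simp
  have chC : ∀ x, HasDerivAt (fun x => (h x : ℂ)) ((deriv h x : ℝ) : ℂ) x :=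
    fun x => (dh x).ofReal_comp
  have cdhC : ∀ x, HasDerivAt (fun x => ((deriv h x : ℝ) : ℂ))
      (((u x + κ ^ 2) * h x : ℝ) : ℂ) x := fun x => (ddh x).ofReal_comp
  have cΓ : ∀ x, HasDerivAt (fun x => (Γ x : ℂ)) ((-c ^ 2 * h x ^ 2 : ℝ) : ℂ) x :=
    fun x => (dΓ x).ofReal_comp
  have hΓC : ∀ x, (Γ x : ℂ) ≠ 0 := fun x => by exact_mod_cast (hΓpos x).ne'
  -- Wronskian identity
  have hW : ∀ x, deriv f x * (h x : ℂ) - f x * ((deriv h x : ℝ) : ℂ)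
      = (k ^ 2 + (κ : ℂ) ^ 2) * I x := by
    have dD : ∀ x, HasDerivAt (fun x => deriv f x * (h x : ℂ) - f x * ((deriv h x : ℝ) : ℂ)
        - (k ^ 2 + (κ : ℂ) ^ 2) * I x) 0 x := fun x => by
      have := (((ddf x).mul (chC x)).sub ((df x).mul (cdhC x))).sub
        ((dI x).const_mul (k ^ 2 + (κ : ℂ) ^ 2))
      refine HasDerivAt.congr_deriv this ?_
      push_cast
      ring
    have hlI : Tendsto I atTop (nhds 0) := by rw [hI]; exact aux_lim g hfhint
    have hl := hlim.sub (hlI.const_mul (k ^ 2 + (κ : ℂ) ^ 2))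
    intro x
    have hconst := is_const_of_deriv_eq_zero (fun x => (dD x).differentiableAt)
      (fun x => (dD x).deriv)
    have h2 := tendsto_nhds_unique (hl.congr fun y => hconst y x) tendsto_const_nhds
    simp only [mul_zero, sub_zero] at h2
    exact sub_eq_zero.mp h2.symm
  have hft' : ft = fun x => f x - (c : ℂ) ^ 2 * (h x : ℂ) * I x / (Γ x : ℂ) := by
    rw [hI]; exact funext hft
  have d1 : ∀ x, HasDerivAt ft (deriv f x - (c : ℂ) ^ 2 * (((deriv h x : ℝ) : ℂ) * I x
      - (h x : ℂ) ^ 2 * f x) / (Γ x : ℂ)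
      - (c : ℂ) ^ 4 * (h x : ℂ) ^ 3 * I x / (Γ x : ℂ) ^ 2) x := fun x => by
    rw [hft']
    have := (df x).sub ((((chC x).const_mul ((c : ℂ) ^ 2)).mul (dI x)).div (cΓ x) (hΓC x))
    refine HasDerivAt.congr_deriv this ?_
    have := hΓC x
    push_cast
    simp only [Pi.mul_apply]
    field_simp
    ring
  have hd1 := funext fun x => (d1 x).deriv
  obtain ⟨D2, d2, hD2⟩ : ∃ D2 : ℝ → ℂ, (∀ x, HasDerivAt (deriv ft) (D2 x) x) ∧
      ∀ x, D2 x = ((u x : ℂ) - k ^ 2) * f x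
        - (c : ℂ) ^ 2 * (((u x : ℂ) + (κ : ℂ) ^ 2) * h x * I x
          - (deriv h x : ℝ) * (f x * h x) - 2 * (h x : ℂ) * (deriv h x : ℝ) * f x
          - (h x : ℂ) ^ 2 * deriv f x) / (Γ x : ℂ)
        - (c : ℂ) ^ 4 * (h x : ℂ) ^ 2 * (((deriv h x : ℝ) : ℂ) * I x
          - (h x : ℂ) ^ 2 * f x) / (Γ x : ℂ) ^ 2
        - (c : ℂ) ^ 4 * (3 * (h x : ℂ) ^ 2 * (deriv h x : ℝ) * I x
          - (h x : ℂ) ^ 4 * f x) / (Γ x : ℂ) ^ 2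
        - 2 * (c : ℂ) ^ 6 * (h x : ℂ) ^ 5 * I x / (Γ x : ℂ) ^ 3 := by
    refine ⟨_, fun x => ?_, fun x => rfl⟩
    rw [hd1]
    have := ((ddf x).sub (((((cdhC x).mul (dI x)).sub (((chC x).pow 2).mul (df x))).const_mul
      ((c : ℂ) ^ 2)).div (cΓ x) (hΓC x))).sub
      (((((chC x).pow 3).const_mul ((c : ℂ) ^ 4)).mul (dI x)).div ((cΓ x).pow 2)
        (pow_ne_zero 2 (hΓC x)))
    refine HasDerivAt.congr_deriv this ?_
    have := hΓC x
    push_cast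
    simp only [Pi.mul_apply, Pi.pow_apply, Pi.sub_apply]
    field_simp
    ring
  have hlog1 : deriv (fun t => Real.log (Γ t)) = fun x => (-c ^ 2 * h x ^ 2) / Γ x :=
    funext fun x => ((dΓ x).log (hΓpos x).ne').deriv
  have hlog2 : ∀ x, deriv (deriv fun t => Real.log (Γ t)) x
      = -2 * c ^ 2 * h x * deriv h x / Γ x - c ^ 4 * h x ^ 4 / Γ x ^ 2 := fun x => by
    rw [hlog1]
    have := ((((dh x).pow 2).const_mul (-c ^ 2)).div (dΓ x) (hΓpos x).ne').deriv
    refine Eq.trans this ?_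
    have := (hΓpos x).ne'
    simp only [Pi.pow_apply]
    field_simp
    push_cast
    ring
  refine ⟨hΓpos, ⟨fun x => (d1 x).differentiableAt, fun x => (d2 x).differentiableAt⟩, ?_⟩
  intro x
  rw [(d2 x).deriv, hD2, hut, hlog2, hft']
  have hx := hΓC x
  have hw := hW x
  push_cast
  generalize (Γ x : ℂ) = G at *
  generalize (h x : ℂ) = H at *
  generalize ((deriv h x : ℝ) : ℂ) = H' at *
  generalize deriv f x = F' at *
  generalize f x = F at *
  generalize I x = J at *
  field_simp
  linear_combination (-(c:ℂ)^2 * H * G^2) * hw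
end

section
/- Let u: ℝ → ℝ be continuous, let κ > 0 and c > 0 be real, and let k ∈ ℂ. Let h: ℝ → ℝ be twice continuously differentiable with −h'' + u·h = −κ²·h on ℝ, and let f: ℝ → ℂ be twice continuously differentiable with −f'' + u·f = k²·f on ℝ. Assume: h² is integrable on (−∞,a) for every a ∈ ℝ; f·h is integrable on (−∞,a) for every a ∈ ℝ; f'(y)h(y) − f(y)h'(y) → 0 as y → −∞. Define Γ(x) := 1 + c²·∫_{−∞}^x h(z)² dz (so Γ(x) > 0), the perturbed potential ũ(x) := u(x) − 2·(d²/dx²) log Γ(x), and the perturbed wavefunction f̃(x) := f(x) − c²·h(x)·(∫_{−∞}^x f(y)h(y) dy) / Γ(x). Then f̃ is twice differentiable and −f̃''(x) + ũ(x)·f̃(x) = k²·f̃(x) for all x ∈ ℝ. -/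
open MeasureTheory Set Filter

lemma hasDerivAt_Iio_aux {E : Type*} [NormedAddCommGroup E] [NormedSpace ℝ E] [CompleteSpace E]
    (φ : ℝ → E) (hφ : Continuous φ) (hi : ∀ a : ℝ, IntegrableOn φ (Iio a)) (x : ℝ) :
    HasDerivAt (fun t => ∫ z in Iio t, φ z) (φ x) x := by
  have hi2 : ∀ a : ℝ, IntegrableOn φ (Iic a) := fun a =>
    (hi (a + 1)).mono_set (fun y hy => by simp only [mem_Iic, mem_Iio] at *; linarith)
  have e : (fun t => ∫ z in Iio t, φ z) = fun t => (∫ z in Iic (0:ℝ), φ z) + ∫ z in (0:ℝ)..t, φ z := by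
    funext t
    rw [← integral_Iic_eq_integral_Iio, ← intervalIntegral.integral_Iic_sub_Iic (hi2 0) (hi2 t)]
    abel
  rw [e]
  exact (hφ.integral_hasStrictDerivAt 0 x).hasDerivAt.const_add _

/-- the Darboux transformation on the full line, expressed through the
Marchenko equation on `(−∞,x)`: the transformed wavefunction `f̃` solves the Schrödinger
equation with the transformed potential `ũ` at energy `k²`. -/
theorem darboux_transformation_Iio
    (u : ℝ → ℝ) (hu : Continuous u) (κ c : ℝ) (hκ : 0 < κ) (hc : 0 < c) (k : ℂ)
    (h : ℝ → ℝ) (hh : ContDiff ℝ 2 h)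
    (hheq : ∀ x, -(deriv (deriv h) x) + u x * h x = -κ ^ 2 * h x)
    (f : ℝ → ℂ) (hf : ContDiff ℝ 2 f)
    (hfeq : ∀ x, -(deriv (deriv f) x) + (u x : ℂ) * f x = k ^ 2 * f x)
    (hh2int : ∀ a : ℝ, IntegrableOn (fun z => h z ^ 2) (Iio a))
    (hfhint : ∀ a : ℝ, IntegrableOn (fun y => f y * (h y : ℂ)) (Iio a))
    (hlim : Tendsto (fun y => deriv f y * (h y : ℂ) - f y * ((deriv h y : ℝ) : ℂ))
      atBot (nhds 0))
    -- Γ(x) = 1 + c² ∫_{−∞}^x h(z)² dz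
    (Γ : ℝ → ℝ) (hΓ : ∀ x, Γ x = 1 + c ^ 2 * ∫ z in Iio x, h z ^ 2)
    -- the perturbed potential ũ(x) = u(x) − 2 (log Γ(x))''
    (ut : ℝ → ℝ)
    (hut : ∀ x, ut x = u x - 2 * deriv (deriv fun t => Real.log (Γ t)) x)
    -- the perturbed wavefunction f̃(x) = f(x) − c² h(x) (∫_{−∞}^x f h) / Γ(x)
    (ft : ℝ → ℂ)
    (hft : ∀ x, ft x = f x
      - (c : ℂ) ^ 2 * (h x : ℂ) * (∫ y in Iio x, f y * (h y : ℂ)) / (Γ x : ℂ)) :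
    (∀ x, 0 < Γ x) ∧ (Differentiable ℝ ft ∧ Differentiable ℝ (deriv ft)) ∧
      ∀ x, -(deriv (deriv ft) x) + (ut x : ℂ) * ft x = k ^ 2 * ft x := by
  have hΓpos : ∀ x, 0 < Γ x := by
    intro x
    rw [hΓ]
    have : 0 ≤ ∫ z in Iio x, h z ^ 2 := integral_nonneg (fun z => sq_nonneg _)
    positivity
  have h0 : ∀ x, HasDerivAt h (deriv h x) x := fun x =>
    (hh.differentiable (by norm_num) x).hasDerivAt
  have f0 : ∀ x, HasDerivAt f (deriv f x) x := fun x =>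
    (hf.differentiable (by norm_num) x).hasDerivAt
  have h1 : ∀ x, HasDerivAt (deriv h) (u x * h x + κ ^ 2 * h x) x := fun x => by
    have h2 : ContDiff ℝ 1 (deriv h) := ContDiff.deriv' (n := 1) (by simpa [one_add_one_eq_two] using hh)
    have := (h2.differentiable (by norm_num) x).hasDerivAt
    refine this.congr_deriv ?_
    linear_combination -hheq x
  have f1 : ∀ x, HasDerivAt (deriv f) ((u x : ℂ) * f x - k ^ 2 * f x) x := fun x => by
    have h2 : ContDiff ℝ 1 (deriv f) := ContDiff.deriv' (n := 1) (by simpa [one_add_one_eq_two] using hf)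
    have := (h2.differentiable (by norm_num) x).hasDerivAt
    refine this.congr_deriv ?_
    linear_combination -hfeq x
  have H0 : ∀ x, HasDerivAt (fun y => (h y : ℂ)) ((deriv h x : ℝ) : ℂ) x :=
    fun x => (h0 x).ofReal_comp
  have H1 : ∀ x, HasDerivAt (fun y => ((deriv h y : ℝ) : ℂ))
      ((u x : ℂ) * (h x : ℂ) + (κ : ℂ) ^ 2 * (h x : ℂ)) x :=
    fun x => by simpa using (h1 x).ofReal_comp
  have hcont : Continuous h := hh.continuous
  have fcont : Continuous f := hf.continuous
  have dΓ : ∀ x, HasDerivAt Γ (c ^ 2 * h x ^ 2) x := fun x => by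
    have e : Γ = fun t => 1 + c ^ 2 * ∫ z in Iio t, h z ^ 2 := funext hΓ
    rw [e]
    exact ((hasDerivAt_Iio_aux _ (by fun_prop) hh2int x).const_mul _).const_add _
  have dG : ∀ x, HasDerivAt (fun y => (Γ y : ℂ)) ((c : ℂ) ^ 2 * (h x : ℂ) ^ 2) x :=
    fun x => by simpa using (dΓ x).ofReal_comp
  have hG : ∀ x, (Γ x : ℂ) ≠ 0 := fun x => by exact_mod_cast (hΓpos x).ne'
  obtain ⟨I, hI⟩ : ∃ I : ℝ → ℂ, I = fun x => ∫ y in Iio x, f y * (h y : ℂ) := ⟨_, rfl⟩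
  have dI : ∀ x, HasDerivAt I (f x * (h x : ℂ)) x := fun x => by
    rw [hI]
    exact hasDerivAt_Iio_aux _ (by fun_prop) hfhint x
  have hW : ∀ x, -(k ^ 2 + (κ : ℂ) ^ 2) * I x
      = deriv f x * (h x : ℂ) - f x * ((deriv h x : ℝ) : ℂ) := by
    intro x
    have hd : ∀ y ∈ Iic x, HasDerivAt
        (fun y => deriv f y * (h y : ℂ) - f y * ((deriv h y : ℝ) : ℂ))
        (-(k ^ 2 + (κ : ℂ) ^ 2) * (f y * (h y : ℂ))) y := by
      intro y _
      refine (((f1 y).mul (H0 y)).sub ((f0 y).mul (H1 y))).congr_deriv ?_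
      ring
    have hint : IntegrableOn (fun y => -(k ^ 2 + (κ : ℂ) ^ 2) * (f y * (h y : ℂ))) (Iic x) :=
      Integrable.const_mul ((hfhint (x + 1)).mono_set
        (fun y hy => by simp only [mem_Iic, mem_Iio] at *; linarith)) _
    have := integral_Iic_of_hasDerivAt_of_tendsto' hd hint hlim
    rw [integral_const_mul, integral_Iic_eq_integral_Iio, sub_zero] at this
    rw [hI]
    exact this
  have eft : ft = fun x => f x - (c : ℂ) ^ 2 * (h x : ℂ) * I x / (Γ x : ℂ) := by
    funext x
    rw [hft, hI]
  have d1 : ∀ x, HasDerivAt ft (deriv f x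
      - (((c : ℂ) ^ 2 * ((deriv h x : ℝ) : ℂ) * I x + (c : ℂ) ^ 2 * (h x : ℂ) * (f x * (h x : ℂ)))
        * (Γ x : ℂ) - (c : ℂ) ^ 2 * (h x : ℂ) * I x * ((c : ℂ) ^ 2 * (h x : ℂ) ^ 2))
        / (Γ x : ℂ) ^ 2) x := fun x => by
    rw [eft]
    exact (f0 x).sub ((((H0 x).const_mul _).mul (dI x)).div (dG x) (hG x))
  have e1 := funext fun x => (d1 x).deriv
  have d2 := fun x => (f1 x).sub (((((((H1 x).const_mul ((c : ℂ) ^ 2)).mul (dI x)).add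
      (((H0 x).const_mul ((c : ℂ) ^ 2)).mul ((f0 x).mul (H0 x)))).mul (dG x)).sub
      ((((H0 x).const_mul ((c : ℂ) ^ 2)).mul (dI x)).mul (((H0 x).pow 2).const_mul ((c : ℂ) ^ 2)))).div
      ((dG x).pow 2) (pow_ne_zero 2 (hG x)))
  have d2' := fun x => (d2 x).congr_of_eventuallyEq (f₁ := deriv ft)
    (Eventually.of_forall fun y => by rw [e1]; rfl)
  have l1 : (deriv fun t => Real.log (Γ t)) = fun x => c ^ 2 * h x ^ 2 / Γ x :=
    funext fun x => ((dΓ x).log (hΓpos x).ne').deriv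
  have l2 := fun x => ((((h0 x).pow 2).const_mul (c ^ 2)).div (dΓ x) (hΓpos x).ne').deriv
  refine ⟨hΓpos, ⟨fun x => (d1 x).differentiableAt, fun x => (d2' x).differentiableAt⟩, ?_⟩
  intro x
  have l3 : deriv (deriv fun t => Real.log (Γ t)) x
      = (2 * c ^ 2 * h x * deriv h x * Γ x - c ^ 4 * h x ^ 4) / Γ x ^ 2 := by
    rw [l1]
    refine (l2 x).trans ?_
    simp
    ring
  rw [(d2' x).deriv, hut, l3, eft]
  have hWx := hW x
  have hGx := hG x
  simp only [Pi.mul_apply, Pi.pow_apply, Pi.add_apply, Pi.sub_apply]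
  push_cast
  generalize (Γ x : ℂ) = G at *
  generalize ((deriv h x : ℝ) : ℂ) = H' at *
  generalize (h x : ℂ) = H at *
  generalize I x = J at *
  generalize deriv f x = F' at *
  generalize f x = F at *
  generalize (c : ℂ) = C at *
  field_simp
  linear_combination (-(G ^ 2 * C ^ 2 * H)) * hWx
end

section
/- Let c > 0 and κ > 0 be real numbers. Define α(x,y) := −c²·e^{κ(x+y)} / (1 + (c²/(2κ))·e^{2κx}). Then for all real x and y one has α(x,y) + c²·e^{κ(x+y)} + ∫_{−∞}^x α(x,s)·c²·e^{κ(s+y)} ds = 0; that is, α solves the fundamental integral equation on (−∞,x) with kernel ω(z,y) = c²·e^{κ(z+y)}. -/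
open MeasureTheory Set

/-- `α(x,y) = −c² e^{κ(x+y)} / (1 + (c²/(2κ)) e^{2κx})` solves the
fundamental integral equation on `(−∞,x)` with kernel `ω(z,y) = c² e^{κ(z+y)}`. -/
theorem alpha_solves_fundamental_equation_Iio
    (c κ : ℝ) (hc : 0 < c) (hκ : 0 < κ)
    (α : ℝ → ℝ → ℝ)
    (hα : ∀ x y, α x y =
      -(c ^ 2 * Real.exp (κ * (x + y))) / (1 + c ^ 2 / (2 * κ) * Real.exp (2 * κ * x))) :
    ∀ x y : ℝ,
      α x y + c ^ 2 * Real.exp (κ * (x + y))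
        + ∫ s in Iio x, α x s * (c ^ 2 * Real.exp (κ * (s + y))) = 0 := by
  intro x y
  have hD : (0 : ℝ) < 1 + c ^ 2 / (2 * κ) * Real.exp (2 * κ * x) := by positivity
  have h1 : ∀ s, α x s * (c ^ 2 * Real.exp (κ * (s + y))) =
      -(c ^ 4 * Real.exp (κ * (x + y))) / (1 + c ^ 2 / (2 * κ) * Real.exp (2 * κ * x))
        * Real.exp (2 * κ * s) := by
    intro s
    have h2 : Real.exp (κ * (x + s)) * Real.exp (κ * (s + y)) =
        Real.exp (κ * (x + y)) * Real.exp (2 * κ * s) := by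
      rw [← Real.exp_add, ← Real.exp_add]
      congr 1
      ring
    rw [hα]
    linear_combination
      (-(c ^ 4) / (1 + c ^ 2 / (2 * κ) * Real.exp (2 * κ * x))) * h2
  simp_rw [h1]
  rw [integral_const_mul, ← integral_Iic_eq_integral_Iio,
    integral_exp_mul_Iic (by positivity : 0 < 2 * κ), hα]
  generalize Real.exp (κ * (x + y)) = E
  generalize Real.exp (2 * κ * x) = X at *
  generalize hd : 1 + c ^ 2 / (2 * κ) * X = D at *
  have h3 : c ^ 2 * (X / (2 * κ)) = D - 1 := by rw [← hd]; ring
  have h4 : D * D⁻¹ = 1 := mul_inv_cancel₀ hD.ne'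
  rw [div_eq_mul_inv _ D, div_eq_mul_inv _ D]
  linear_combination (-(c ^ 2 * E * D⁻¹)) * h3 - c ^ 2 * E * h4
end

section
/- Let c > 0 and κ > 0 be real numbers, and fix x ∈ ℝ. Define r(z,y) := −c²·e^{κ(z+y)} / (1 + (c²/(2κ))·e^{2κx}). Then for all real z and y one has r(z,y) + c²·e^{κ(z+y)} + ∫_{−∞}^x r(z,s)·c²·e^{κ(s+y)} ds = 0; that is, r is the resolvent kernel on (−∞,x) corresponding to the kernel ω(z,y) = c²·e^{κ(z+y)}. -/
open MeasureTheory Set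

/-- `r(z,y) = −c² e^{κ(z+y)} / (1 + (c²/(2κ)) e^{2κx})` is the resolvent
kernel on `(−∞,x)` for the kernel `ω(z,y) = c² e^{κ(z+y)}`: it satisfies the resolvent
integral equation. -/
theorem resolvent_kernel_explicit_Iio
    (c κ : ℝ) (hc : 0 < c) (hκ : 0 < κ) (x : ℝ)
    (r : ℝ → ℝ → ℝ)
    (hr : ∀ z y, r z y =
      -(c ^ 2 * Real.exp (κ * (z + y))) / (1 + c ^ 2 / (2 * κ) * Real.exp (2 * κ * x))) :
    ∀ z y : ℝ,
      r z y + c ^ 2 * Real.exp (κ * (z + y))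
        + ∫ s in Iio x, r z s * (c ^ 2 * Real.exp (κ * (s + y))) = 0 := by
  intro z y
  have hI : ∫ s in Iio x, r z s * (c ^ 2 * Real.exp (κ * (s + y)))
      = (-(c ^ 2 * c ^ 2 * Real.exp (κ * (z + y))) /
          (1 + c ^ 2 / (2 * κ) * Real.exp (2 * κ * x))) * (Real.exp (2 * κ * x) / (2 * κ)) := by
    rw [← integral_exp_mul_Iic (by positivity : 0 < 2 * κ) x, integral_Iic_eq_integral_Iio,
      ← integral_const_mul]
    congr 1
    funext s
    have h : Real.exp (κ * (z + s)) * Real.exp (κ * (s + y))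
        = Real.exp (κ * (z + y)) * Real.exp (2 * κ * s) := by
      rw [← Real.exp_add, ← Real.exp_add]
      ring_nf
    rw [hr]
    linear_combination (-(c ^ 2 * c ^ 2) / (1 + c ^ 2 / (2 * κ) * Real.exp (2 * κ * x))) * h
  rw [hI, hr]
  have hD : 0 < 1 + c ^ 2 / (2 * κ) * Real.exp (2 * κ * x) := by positivity
  generalize Real.exp (2 * κ * x) = E at *
  generalize Real.exp (κ * (z + y)) = F at *
  have h2 : c ^ 2 / (2 * κ) * E = (1 + c ^ 2 / (2 * κ) * E) - 1 := by ring
  generalize 1 + c ^ 2 / (2 * κ) * E = D at *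
  have : -(c ^ 2 * F) / D + c ^ 2 * F + -(c ^ 2 * c ^ 2 * F) / D * (E / (2 * κ))
      = -(c ^ 2 * F) / D + c ^ 2 * F - c ^ 2 * F / D * (c ^ 2 / (2 * κ) * E) := by ring
  rw [this, h2]
  field_simp
  ring
end

section
/- Let C > 0 and κ > 0 be real numbers. Define ω(x,y) := (C²/κ²)·sinh(κx)·sinh(κy) and α(x,y) := −(C²/κ²)·sinh(κx)·sinh(κy) / (1 + (C²/κ²)·[sinh(2κx)/(4κ) − x/2]). Then for all x > 0 the denominator 1 + (C²/κ²)·[sinh(2κx)/(4κ) − x/2] is strictly positive, and for all 0 < y < x one has α(x,y) + ω(x,y) + ∫_0^x α(x,z)·ω(z,y) dz = 0; that is, α solves the fundamental integral equation on (0,x) with kernel ω. -/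
open MeasureTheory Set

/-- the explicit `α` solves the fundamental integral equation on `(0,x)`
with the kernel `ω(x,y) = (C²/κ²) sinh(κx) sinh(κy)`, and the denominator appearing in
`α` is strictly positive for `x > 0`. -/
theorem alpha_solves_fundamental_equation_GelfandLevitan
    (C κ : ℝ) (hC : 0 < C) (hκ : 0 < κ)
    (ω α : ℝ → ℝ → ℝ)
    (hω : ∀ x y, ω x y = C ^ 2 / κ ^ 2 * Real.sinh (κ * x) * Real.sinh (κ * y))
    (hα : ∀ x y, α x y =
      -(C ^ 2 / κ ^ 2 * Real.sinh (κ * x) * Real.sinh (κ * y)) /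
        (1 + C ^ 2 / κ ^ 2 * (Real.sinh (2 * κ * x) / (4 * κ) - x / 2))) :
    (∀ x : ℝ, 0 < x →
      0 < 1 + C ^ 2 / κ ^ 2 * (Real.sinh (2 * κ * x) / (4 * κ) - x / 2)) ∧
    ∀ x y : ℝ, 0 < y → y < x →
      α x y + ω x y + ∫ z in (0:ℝ)..x, α x z * ω z y = 0 := by
  have hD : ∀ x : ℝ, 0 < x →
      0 < 1 + C ^ 2 / κ ^ 2 * (Real.sinh (2 * κ * x) / (4 * κ) - x / 2) := by
    intro x hx
    have h1 : 2 * κ * x ≤ Real.sinh (2 * κ * x) := Real.self_le_sinh_iff.2 (by positivity)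
    have h2 : x / 2 ≤ Real.sinh (2 * κ * x) / (4 * κ) := by
      rw [le_div_iff₀ (by positivity)]
      linarith
    have h3 : 0 ≤ Real.sinh (2 * κ * x) / (4 * κ) - x / 2 := by linarith
    positivity
  refine ⟨hD, ?_⟩
  intro x y hy hyx
  have hDx := hD x (hy.trans hyx)
  have hJ : ∫ z in (0:ℝ)..x, Real.sinh (κ * z) ^ 2
      = Real.sinh (2 * κ * x) / (4 * κ) - x / 2 := by
    have hderiv : ∀ z ∈ uIcc (0:ℝ) x, HasDerivAt
        (fun z : ℝ => Real.sinh (2 * κ * z) / (4 * κ) - z / 2) (Real.sinh (κ * z) ^ 2) z := by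
      intro z _
      have h1 : HasDerivAt (fun z : ℝ => 2 * κ * z) (2 * κ * 1) z :=
        (hasDerivAt_id z).const_mul (2 * κ)
      have h2 := (h1.sinh.div_const (4 * κ)).sub ((hasDerivAt_id z).div_const 2)
      refine h2.congr_deriv ?_
      have h3 : Real.cosh (2 * κ * z) = 1 + 2 * Real.sinh (κ * z) ^ 2 := by
        rw [mul_assoc, Real.cosh_two_mul, Real.cosh_sq]
        ring
      rw [h3]
      field_simp
      ring
    rw [intervalIntegral.integral_eq_sub_of_hasDerivAt hderiv
      (Continuous.intervalIntegrable (by fun_prop) _ _)]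
    simp
  have hI : ∫ z in (0:ℝ)..x, α x z * ω z y =
      (-(C ^ 2 / κ ^ 2 * Real.sinh (κ * x)) /
        (1 + C ^ 2 / κ ^ 2 * (Real.sinh (2 * κ * x) / (4 * κ) - x / 2)) *
        (C ^ 2 / κ ^ 2 * Real.sinh (κ * y))) *
        (Real.sinh (2 * κ * x) / (4 * κ) - x / 2) := by
    rw [← hJ, ← intervalIntegral.integral_const_mul]
    congr 1
    funext z
    rw [hα, hω, hJ]
    ring
  rw [hI, hα, hω]
  generalize Real.sinh (2 * κ * x) / (4 * κ) - x / 2 = J at *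
  generalize C ^ 2 / κ ^ 2 = A at *
  have := hDx.ne'
  field_simp
  ring
end
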